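/- Work in ℝ⁴ (n = 4). For every valid list ⟨a₁,…,a_k⟩ over {1,2,3,4} with k ≥ 9, letting N_k = M_{a₁}·M_{a₂}⋯M_{a_k} and c = (1/4,1/4,1/4,1/4), one has ‖N_k·c − c‖ > √3 = 2·√(3/4). (Two facets of an unfolding of the 4-orthoplex separated by eight or more intervening facets have centroids farther apart than twice the circumradius √(3/4), hence cannot overlap.) -/

import Mathlib

/-- The reflection matrix `M_a` for `n = 4` (0-indexed): the identity except that the
`a`-th column has `-1` in the `a`-th entry and `2/3` in every other entry. -/
noncomputable def reflMat4 (a : Fin 4) : Matrix (Fin 4) (Fin 4) ℝ :=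
  fun i j => if j = a then (if i = a then -1 else 2 / 3) else if i = j then 1 else 0

/-- A list over `{1,…,n}` (as `Fin n`) is valid if no nonempty block of consecutive entries
has every value occurring an even number of times (equivalently, it encodes a self-avoiding
path on the 1-skeleton of the `n`-cube). -/
def IsValidList {n : ℕ} (l : List (Fin n)) : Prop :=
  ∀ j k : ℕ, j < k → k ≤ l.length →
    ¬ ∀ m : Fin n, Even (((l.drop j).take (k - j)).count m)

/-- The vertex of the cube reached by the list, each coordinate being one binary digit. -/
def cubeVertex {n : ℕ} : List (Fin n) → ℕ
  | [] => 0
  | a :: l => cubeVertex l ^^^ 1 <<< a.val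

/-- The set of the vertices `cubeVertex t`, for `t` a suffix of the list, as a bit mask. -/
def visitedMask {n : ℕ} : List (Fin n) → ℕ
  | [] => 1
  | a :: l => visitedMask l ||| 1 <<< cubeVertex (a :: l)

/-- The coordinates of the last centroid, multiplied by `4 * 3 ^ l.length`. -/
def scaledCentroid : List (Fin 4) → Fin 4 → ℤ
  | [], _ => 1
  | a :: l, i =>
    if i = a then -3 * scaledCentroid l a else 3 * scaledCentroid l i + 2 * scaledCentroid l a

/-- Depth-first search through the self-avoiding paths that extend a given one at the front of
its list. The arguments are a bound for the depth, the mask of visited vertices, the current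
vertex, the scale `s = 3 ^ length`, and the scaled centroid with each coordinate shifted by
`64 * s` to make it a natural number. The bounds on the coordinates exclude truncation
in the subtractions. -/
def searchFar : ℕ → ℕ → ℕ → ℕ → ℕ → ℕ → ℕ → ℕ → Bool
  | 0, _, _, _, _, _, _, _ => false
  | f + 1, seen, p, s, x, y, z, w =>
    ((Nat.ble (26 * s) x && Nat.ble x (128 * s)) && (Nat.ble (26 * s) y && Nat.ble y (128 * s)) &&
      (Nat.ble (26 * s) z && Nat.ble z (128 * s)) &&
      (Nat.ble (26 * s) w && Nat.ble w (128 * s))) &&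
    (Nat.ble s 19682 ||
      Nat.blt (130 * s * (x + y + z + w)) (x * x + y * y + z * z + w * w + 16852 * (s * s))) &&
    (Nat.testBit seen (p ^^^ 1) ||
      searchFar f (seen ||| 1 <<< (p ^^^ 1)) (p ^^^ 1) (3 * s) (384 * s - 3 * x)
        (3 * y + 2 * x - 128 * s) (3 * z + 2 * x - 128 * s) (3 * w + 2 * x - 128 * s)) &&
    (Nat.testBit seen (p ^^^ 2) ||
      searchFar f (seen ||| 1 <<< (p ^^^ 2)) (p ^^^ 2) (3 * s) (3 * x + 2 * y - 128 * s)
        (384 * s - 3 * y) (3 * z + 2 * y - 128 * s) (3 * w + 2 * y - 128 * s)) &&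
    (Nat.testBit seen (p ^^^ 4) ||
      searchFar f (seen ||| 1 <<< (p ^^^ 4)) (p ^^^ 4) (3 * s) (3 * x + 2 * z - 128 * s)
        (3 * y + 2 * z - 128 * s) (384 * s - 3 * z) (3 * w + 2 * z - 128 * s)) &&
    (Nat.testBit seen (p ^^^ 8) ||
      searchFar f (seen ||| 1 <<< (p ^^^ 8)) (p ^^^ 8) (3 * s) (3 * x + 2 * w - 128 * s)
        (3 * y + 2 * w - 128 * s) (3 * z + 2 * w - 128 * s) (384 * s - 3 * w))

set_option maxRecDepth 100000 in
theorem searchFar_after_two_steps :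
    searchFar 14 11 3 9 577 561 601 601 = true := by
  decide +kernel

theorem cubeVertex_append {n : ℕ} (u v : List (Fin n)) :
    cubeVertex (u ++ v) = cubeVertex u ^^^ cubeVertex v := by
  induction u with
  | nil => simp [cubeVertex]
  | cons a u ih =>
    simp only [List.cons_append, cubeVertex, ih]
    ac_rfl

theorem testBit_cubeVertex {n : ℕ} (l : List (Fin n)) (m : Fin n) :
    (cubeVertex l).testBit m = decide (¬ Even (l.count m)) := by
  induction l with
  | nil => simp [cubeVertex]
  | cons a l ih =>
    simp only [cubeVertex, Nat.testBit_xor, ih, Nat.one_shiftLeft, Nat.testBit_two_pow,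
      List.count_cons, ← Fin.ext_iff]
    by_cases h : a = m <;> by_cases h' : Even (l.count m) <;> simp [h, h', Nat.even_add_one]

theorem exists_suffix_of_testBit_visitedMask {n : ℕ} {l : List (Fin n)} {v : ℕ}
    (h : (visitedMask l).testBit v = true) : ∃ t, t <:+ l ∧ cubeVertex t = v := by
  induction l with
  | nil =>
    refine ⟨[], List.suffix_rfl, ?_⟩
    have := Nat.testBit_two_pow (n := 0) (m := v)
    simp_all [visitedMask, cubeVertex]
  | cons a l ih =>
    simp only [visitedMask, Nat.testBit_or, Nat.one_shiftLeft, Nat.testBit_two_pow,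
      Bool.or_eq_true, decide_eq_true_eq] at h
    rcases h with h | h
    · obtain ⟨t, ht, hv⟩ := ih h
      exact ⟨t, ht.trans (List.suffix_cons a l), hv⟩
    · exact ⟨a :: l, List.suffix_rfl, h⟩

theorem IsValidList.not_even_block {n : ℕ} {u v w : List (Fin n)}
    (h : IsValidList (u ++ (v ++ w))) (hv : v ≠ []) : ¬ ∀ m, Even (v.count m) := by
  have := h u.length (u.length + v.length)
    (by have := List.length_pos_iff.2 hv; omega) (by simp)
  simpa using this

theorem IsValidList.testBit_visitedMask {n : ℕ} {u l : List (Fin n)} {a : Fin n}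
    (h : IsValidList (u ++ a :: l)) :
    (visitedMask l).testBit (cubeVertex (a :: l)) = false := by
  by_contra hbit
  obtain ⟨t, ⟨m, rfl⟩, ht⟩ :=
    exists_suffix_of_testBit_visitedMask (Bool.not_eq_false _ ▸ hbit)
  rw [← List.cons_append, cubeVertex_append] at ht
  have hzero : cubeVertex (a :: m) = 0 := by
    have := congrArg (· ^^^ cubeVertex t) ht
    simpa [Nat.xor_assoc] using this.symm
  refine IsValidList.not_even_block (v := a :: m) (w := t) h (by simp) fun i => ?_
  have := testBit_cubeVertex (a :: m) i
  simpa [hzero] using this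

theorem IsValidList.map {n m : ℕ} {l : List (Fin n)} (h : IsValidList l)
    {σ : Fin n → Fin m} (hσ : Function.Injective σ) : IsValidList (l.map σ) := by
  intro j k hjk hk heven
  refine h j k hjk (by simpa using hk) fun i => ?_
  have := heven (σ i)
  rwa [← List.map_drop, ← List.map_take, List.count_map_of_injective _ _ hσ] at this

theorem scaledCentroid_map (σ : Equiv.Perm (Fin 4)) (l : List (Fin 4)) (i : Fin 4) :
    scaledCentroid (l.map σ) (σ i) = scaledCentroid l i := by
  induction l generalizing i with
  | nil => rfl
  | cons a l ih => simp [scaledCentroid, ih]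

/-- The centroid of the last facet is farther than `√3` from that of the first facet. -/
def IsFar (l : List (Fin 4)) : Prop :=
  48 * (3 ^ l.length) ^ 2 < ∑ i, (scaledCentroid l i - 3 ^ l.length) ^ 2

theorem isFar_map_iff (σ : Equiv.Perm (Fin 4)) (l : List (Fin 4)) :
    IsFar (l.map σ) ↔ IsFar l := by
  unfold IsFar
  rw [← Equiv.sum_comp σ]
  simp [scaledCentroid_map]

theorem isFar_of_searchFar (f : ℕ) (r l : List (Fin 4)) (s x y z w : ℕ)
    (hs : s = 3 ^ l.length)
    (hx : (x : ℤ) = scaledCentroid l 0 + 64 * s) (hy : (y : ℤ) = scaledCentroid l 1 + 64 * s)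
    (hz : (z : ℤ) = scaledCentroid l 2 + 64 * s) (hw : (w : ℤ) = scaledCentroid l 3 + 64 * s)
    (hsearch : searchFar f (visitedMask l) (cubeVertex l) s x y z w = true)
    (hval : IsValidList (r.reverse ++ l)) (hlen : 9 ≤ (r.reverse ++ l).length) :
    IsFar (r.reverse ++ l) := by
  induction f generalizing r l s x y z w with
  | zero => simp [searchFar] at hsearch
  | succ f ih =>
    simp only [searchFar, Bool.and_eq_true, Bool.or_eq_true, Nat.ble_eq, Nat.blt_eq] at hsearch
    obtain ⟨⟨⟨⟨⟨⟨⟨⟨⟨hx₁, hx₂⟩, hy₁, hy₂⟩, hz₁, hz₂⟩, hw₁, hw₂⟩, hfar⟩, h0⟩, h1⟩, h2⟩, h3⟩ :=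
      hsearch
    cases r with
    | nil =>
      simp only [List.reverse_nil, List.nil_append] at hlen ⊢
      have hbig : 19683 ≤ s := hs ▸ Nat.pow_le_pow_right (n := 3) (by norm_num) hlen
      have hlt := hfar.resolve_left (by omega)
      have hs' : (3 : ℤ) ^ l.length = s := by rw [hs]; push_cast; rfl
      zify at hlt
      unfold IsFar
      rw [hs', Fin.sum_univ_four, ← sub_eq_iff_eq_add.2 hx, ← sub_eq_iff_eq_add.2 hy,
        ← sub_eq_iff_eq_add.2 hz, ← sub_eq_iff_eq_add.2 hw]
      linarith
    | cons a r =>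
      rw [List.reverse_cons, List.append_assoc, List.singleton_append] at hval hlen ⊢
      have hnew := hval.testBit_visitedMask
      have hs' : 3 * s = 3 ^ (a :: l).length := by rw [hs, List.length_cons, pow_succ']
      fin_cases a
      · exact ih r _ _ _ _ _ _ hs' (by simp [scaledCentroid]; omega)
          (by simp [scaledCentroid]; omega) (by simp [scaledCentroid]; omega)
          (by simp [scaledCentroid]; omega) (h0.resolve_left (Bool.eq_false_iff.1 hnew)) hval hlen
      · exact ih r _ _ _ _ _ _ hs' (by simp [scaledCentroid]; omega)
          (by simp [scaledCentroid]; omega) (by simp [scaledCentroid]; omega)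
          (by simp [scaledCentroid]; omega) (h1.resolve_left (Bool.eq_false_iff.1 hnew)) hval hlen
      · exact ih r _ _ _ _ _ _ hs' (by simp [scaledCentroid]; omega)
          (by simp [scaledCentroid]; omega) (by simp [scaledCentroid]; omega)
          (by simp [scaledCentroid]; omega) (h2.resolve_left (Bool.eq_false_iff.1 hnew)) hval hlen
      · exact ih r _ _ _ _ _ _ hs' (by simp [scaledCentroid]; omega)
          (by simp [scaledCentroid]; omega) (by simp [scaledCentroid]; omega)
          (by simp [scaledCentroid]; omega) (h3.resolve_left (Bool.eq_false_iff.1 hnew)) hval hlen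

theorem exists_perm_apply_eq_zero_one :
    ∀ a b : Fin 4, a ≠ b → ∃ σ : Equiv.Perm (Fin 4), σ a = 0 ∧ σ b = 1 := by
  decide

theorem IsValidList.isFar {l : List (Fin 4)} (hval : IsValidList l) (hlen : 9 ≤ l.length) :
    IsFar l := by
  obtain ⟨r, rfl⟩ : ∃ r : List (Fin 4), l = r.reverse := ⟨l.reverse, by simp⟩
  match r with
  | [] | [_] => simp at hlen
  | a :: b :: r =>
    have hsplit : (a :: b :: r).reverse = r.reverse ++ [b, a] := by simp
    rw [hsplit] at hval hlen ⊢
    have hab : a ≠ b := by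
      rintro rfl
      refine IsValidList.not_even_block (v := [a, a]) (w := []) hval (by simp) fun m => ?_
      by_cases h : a = m <;> simp [h]
    obtain ⟨σ, ha, hb⟩ := exists_perm_apply_eq_zero_one a b hab
    have hmap : (r.reverse ++ [b, a]).map σ = (r.map σ).reverse ++ [1, 0] := by
      simp [ha, hb]
    rw [← isFar_map_iff σ, hmap]
    refine isFar_of_searchFar 14 _ _ 9 577 561 601 601 rfl rfl rfl rfl rfl
      searchFar_after_two_steps ?_ ?_
    · exact hmap ▸ hval.map σ.injective
    · simpa using hlen

theorem prod_reflMat4_mulVec (l : List (Fin 4)) :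
    (l.map reflMat4).prod.mulVec (fun _ => 1 / 4) =
      fun i => (scaledCentroid l i : ℝ) / (4 * 3 ^ l.length) := by
  induction l with
  | nil => simp [scaledCentroid]
  | cons a l ih =>
    rw [List.map_cons, List.prod_cons, ← Matrix.mulVec_mulVec, ih]
    ext i
    simp only [Matrix.mulVec, dotProduct, reflMat4, Fin.sum_univ_four, scaledCentroid,
      List.length_cons, pow_succ]
    fin_cases a <;> fin_cases i <;> simp <;> field_simp <;> ring

/-- For every valid list over `{1,2,3,4}` of length at least `9`, the centroid `N_k·c` of the
last facet of the chain unfolding is at Euclidean distance greater than `√3 = 2·√(3/4)` from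
the centroid `c = (1/4,…,1/4)` of the first facet: facets of an unfolding of the 4-orthoplex
separated by eight or more facets cannot overlap. -/
theorem valid_long_list_centroids_far (l : List (Fin 4)) (hlen : 9 ≤ l.length)
    (hval : IsValidList l) (c : Fin 4 → ℝ) (hc : c = fun _ => 1 / 4) :
    Real.sqrt 3 <
      ‖(EuclideanSpace.equiv (Fin 4) ℝ).symm ((l.map reflMat4).prod.mulVec c - c)‖ := by
  have hfar : (48 * (3 ^ l.length) ^ 2 : ℝ) <
      ∑ i, ((scaledCentroid l i : ℝ) - 3 ^ l.length) ^ 2 := by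
    exact_mod_cast hval.isFar hlen
  rw [hc, prod_reflMat4_mulVec, EuclideanSpace.norm_eq]
  refine Real.sqrt_lt_sqrt (by norm_num) ?_
  have hs : (0 : ℝ) < 3 ^ l.length := by positivity
  have hterm (i : Fin 4) : ‖(EuclideanSpace.equiv (Fin 4) ℝ).symm
      ((fun i => (scaledCentroid l i : ℝ) / (4 * 3 ^ l.length)) - fun _ => 1 / 4) i‖ ^ 2 =
      ((scaledCentroid l i : ℝ) - 3 ^ l.length) ^ 2 / (16 * (3 ^ l.length) ^ 2) := by
    simp only [Real.norm_eq_abs, sq_abs, PiLp.continuousLinearEquiv_symm_apply, Pi.sub_apply]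
    field_simp
    ring
  rw [Finset.sum_congr rfl fun i _ => hterm i, ← Finset.sum_div, lt_div_iff₀ (by positivity)]
  linarith
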